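/- Let W ∈ ℝ^{C×L} be a matrix of class-wise layer scores with rows w_c, let τ > 0, and let z^{(1)}, …, z^{(L)} ∈ ℝ^{d} satisfy ‖z^{(l)}‖_2 ≤ B for all l, with B > 0. Define the class-conditioned fused token z̄(w_c) = Σ_{l=1}^L softmax(τ w_c)_l · z^{(l)}. Then for any two classes c and c', the fused-token drift caused by misrouting c → c' satisfies ‖z̄(w_c) − z̄(w_{c'})‖_2 ≤ (B τ / 2) ‖w_c − w_{c'}‖_1. -/

import Mathlib

/-- Componentwise softmax of a vector in `ℝ^L`. -/
noncomputable def softmax {L : ℕ} (u : Fin L → ℝ) : Fin L → ℝ :=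
  fun l => Real.exp (u l) / ∑ k, Real.exp (u k)

theorem softmax_nonneg {L : ℕ} (u : Fin L → ℝ) (l : Fin L) : 0 ≤ softmax u l := by
  unfold softmax
  positivity

theorem sum_exp_pos {L : ℕ} [NeZero L] (u : Fin L → ℝ) : 0 < ∑ k, Real.exp (u k) :=
  Finset.sum_pos (fun _ _ => Real.exp_pos _) Finset.univ_nonempty

theorem sum_softmax {L : ℕ} [NeZero L] (u : Fin L → ℝ) : ∑ l, softmax u l = 1 := by
  unfold softmax
  rw [← Finset.sum_div, div_self (sum_exp_pos u).ne']

/-- The derivative of softmax along a line with direction `a`. -/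
theorem hasDerivAt_softmax_line {L : ℕ} [NeZero L] (v a : Fin L → ℝ) (t : ℝ) (l : Fin L) :
    HasDerivAt (fun s : ℝ => softmax (v + s • a) l)
      (softmax (v + t • a) l * (a l - ∑ k, softmax (v + t • a) k * a k)) t := by
  have hexp (k : Fin L) : HasDerivAt (fun s : ℝ => Real.exp ((v + s • a) k))
      (Real.exp ((v + t • a) k) * a k) t := by
    have h := (((hasDerivAt_id t).mul_const (a k)).const_add (v k)).exp
    simpa using h
  have hS := (sum_exp_pos (v + t • a)).ne'
  have h := (hexp l).fun_div (HasDerivAt.fun_sum fun k (_ : k ∈ Finset.univ) => hexp k) hS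
  refine h.congr_deriv ?_
  simp only [softmax, div_mul_eq_mul_div, ← Finset.sum_div]
  field_simp

/-- The mean absolute deviation of `a` under a probability vector `p` is at most half
the `ℓ1` norm of `a`. -/
theorem sum_mul_abs_sub_mean_le {ι : Type*} [Fintype ι] (p a : ι → ℝ)
    (hp : ∀ i, 0 ≤ p i) (hsum : ∑ i, p i = 1) :
    ∑ i, p i * |a i - ∑ k, p k * a k| ≤ 1 / 2 * ∑ i, |a i| := by
  classical
  set M := ∑ k, p k * |a k| with hM
  have hdev (i : ι) : |a i - ∑ k, p k * a k| ≤ (1 - 2 * p i) * |a i| + M := by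
    have hi : p i ≤ 1 := hsum ▸ Finset.single_le_sum (fun k _ => hp k) (Finset.mem_univ i)
    have hrest : |∑ k ∈ Finset.univ.erase i, p k * a k| ≤
        ∑ k ∈ Finset.univ.erase i, p k * |a k| := by
      refine (Finset.abs_sum_le_sum_abs _ _).trans_eq (Finset.sum_congr rfl fun k _ => ?_)
      rw [abs_mul, abs_of_nonneg (hp k)]
    have h₁ := Finset.add_sum_erase Finset.univ (fun k => p k * a k) (Finset.mem_univ i)
    have h₂ := Finset.add_sum_erase Finset.univ (fun k => p k * |a k|) (Finset.mem_univ i)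
    calc |a i - ∑ k, p k * a k|
        = |(1 - p i) * a i - ∑ k ∈ Finset.univ.erase i, p k * a k| := by
          rw [← h₁]; ring_nf
      _ ≤ |(1 - p i) * a i| + |∑ k ∈ Finset.univ.erase i, p k * a k| := abs_sub _ _
      _ ≤ (1 - 2 * p i) * |a i| + M := by
          rw [abs_mul, abs_of_nonneg (sub_nonneg.2 hi)]
          linarith
  calc ∑ i, p i * |a i - ∑ k, p k * a k|
      ≤ ∑ i, p i * ((1 - 2 * p i) * |a i| + M) :=
        Finset.sum_le_sum fun i _ => mul_le_mul_of_nonneg_left (hdev i) (hp i)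
    _ = ∑ i, 2 * (p i * (1 - p i)) * |a i| := by
        simp_rw [mul_add]
        rw [Finset.sum_add_distrib, ← Finset.sum_mul, hsum, one_mul, hM,
          ← Finset.sum_add_distrib]
        exact Finset.sum_congr rfl fun i _ => by ring
    _ ≤ ∑ i, 1 / 2 * |a i| := Finset.sum_le_sum fun i _ =>
        mul_le_mul_of_nonneg_right (by nlinarith [sq_nonneg (2 * p i - 1)]) (abs_nonneg _)
    _ = 1 / 2 * ∑ i, |a i| := by rw [Finset.mul_sum]

/-- A softmax-weighted combination of vectors of norm at most `B` is `B / 2`-Lipschitz in the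
logits with respect to the `ℓ1` norm. -/
theorem norm_sum_softmax_smul_sub_le {E : Type*} [NormedAddCommGroup E] [NormedSpace ℝ E]
    {L : ℕ} {B : ℝ} (z : Fin L → E) (hz : ∀ l, ‖z l‖ ≤ B) (u v : Fin L → ℝ) :
    ‖(∑ l, softmax u l • z l) - ∑ l, softmax v l • z l‖ ≤ B / 2 * ∑ l, |u l - v l| := by
  rcases Nat.eq_zero_or_pos L with rfl | hL
  · simp
  have : NeZero L := ⟨hL.ne'⟩
  have hB : 0 ≤ B := (norm_nonneg _).trans (hz 0)
  have hderiv (t : ℝ) := HasDerivAt.fun_sum fun l (_ : l ∈ Finset.univ) =>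
    (hasDerivAt_softmax_line v (u - v) t l).smul_const (z l)
  have h := norm_image_sub_le_of_norm_deriv_le_segment_01'
    (C := B / 2 * ∑ l, |u l - v l|) (fun t _ => (hderiv t).hasDerivWithinAt) fun t _ => ?_
  · simpa using h
  set p := softmax (v + t • (u - v))
  calc ‖∑ l, (p l * ((u - v) l - ∑ k, p k * (u - v) k)) • z l‖
      ≤ ∑ l, p l * |(u - v) l - ∑ k, p k * (u - v) k| * B := by
        refine norm_sum_le_of_le _ fun l _ => ?_
        have hp : 0 ≤ p l := softmax_nonneg _ l
        rw [norm_smul, Real.norm_eq_abs, abs_mul, abs_of_nonneg hp]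
        exact mul_le_mul_of_nonneg_left (hz l) (by positivity)
    _ ≤ (1 / 2 * ∑ l, |(u - v) l|) * B := by
        rw [← Finset.sum_mul]
        exact mul_le_mul_of_nonneg_right
          (sum_mul_abs_sub_mean_le p (u - v) (softmax_nonneg _) (sum_softmax _)) hB
    _ = B / 2 * ∑ l, |u l - v l| := by
        simp only [Pi.sub_apply]
        ring

/-- **Misrouting sensitivity bound.** Let `W ∈ ℝ^{C×L}` be class-wise layer scores with
rows `w_c`, let `τ > 0`, and let layer tokens `z^{(l)}` have norm at most `B > 0`. With
class-conditioned fused token `z̄(w_c) = ∑ l, softmax(τ w_c)_l • z^{(l)}`, for any two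
classes `c, c'` the drift caused by misrouting `c → c'` satisfies
`‖z̄(w_c) − z̄(w_{c'})‖₂ ≤ (B τ / 2) ‖w_c − w_{c'}‖₁`. -/
theorem misrouting_drift_bound {C L d : ℕ} (W : Fin C → Fin L → ℝ)
    (τ : ℝ) (hτ : 0 < τ) (B : ℝ) (hB : 0 < B)
    (z : Fin L → EuclideanSpace ℝ (Fin d)) (hz : ∀ l, ‖z l‖ ≤ B)
    (c c' : Fin C) :
    ‖(∑ l, softmax (τ • W c) l • z l) - ∑ l, softmax (τ • W c') l • z l‖ ≤
      (B * τ / 2) * ∑ l, |W c l - W c' l| := by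
  refine (norm_sum_softmax_smul_sub_le z hz _ _).trans_eq ?_
  simp only [Pi.smul_apply, smul_eq_mul, ← mul_sub, abs_mul, abs_of_pos hτ, ← Finset.mul_sum]
  ring
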